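/- Let β > 0, b₁, b₂ > 0, ρ ≥ 0, σ ≥ 0 with ρ + b₁ < β and σ + b₂ < β, and 0 ≤ τ < t. Define J(x,ξ,t,τ) = ∫_τ^t (t−θ)^{−ρ/β}(θ−τ)^{−σ/β} ∫_{ℚₚⁿ} ((t−θ)^{1/β} + ‖x−η‖ₚ)^{−n−b₁} ((θ−τ)^{1/β} + ‖η−ξ‖ₚ)^{−n−b₂} dⁿη dθ. Then J(x,ξ,t,τ) ≤ C { B(1−ρ/β, 1−(σ+b₂)/β) ((t−τ)^{1/β}+‖x−ξ‖ₚ)^{−n−b₁} (t−τ)^{−(ρ+σ+b₂−β)/β} + B(1−(ρ+b₁)/β, 1−σ/β) ((t−τ)^{1/β}+‖x−ξ‖ₚ)^{−n−b₂} (t−τ)^{−(ρ+σ+b₁−β)/β} }, where C depends only on b₁, b₂ and B denotes the Euler Beta function. -/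

import Mathlib

open MeasureTheory

/-- The classical Euler Beta function `B(a,b) = ∫₀¹ s^(a−1) (1−s)^(b−1) ds`. -/
noncomputable def realBeta (a b : ℝ) : ℝ :=
  ∫ s in Set.Ioo (0 : ℝ) 1, s ^ (a - 1) * (1 - s) ^ (b - 1)


lemma aux_cover {p : ℕ} [Fact p.Prime] (y : ℚ_[p]) (hy : ‖y‖ ≤ 1) :
    ∃ a : Fin p, ‖y - (a : ℕ)‖ ≤ (p : ℝ)⁻¹ := by
  obtain ⟨a, ha⟩ := (PadicInt.existsUnique_mem_range (⟨y, hy⟩ : ℤ_[p])).exists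
  refine ⟨⟨a, ha.1⟩, ?_⟩
  have h2 := ha.2
  rw [PadicInt.maximalIdeal_eq_span_p, ← pow_one (p : ℤ_[p]),
    ← PadicInt.norm_le_pow_iff_mem_span_pow] at h2
  have h3 : ‖y - (a : ℚ_[p])‖ ≤ (p : ℝ) ^ (-((1 : ℕ) : ℤ)) := by
    rw [PadicInt.norm_def] at h2
    push_cast at h2
    exact h2
  simpa using h3

lemma aux_inj {p : ℕ} [Fact p.Prime] (y : ℚ_[p]) (a b : Fin p)
    (ha : ‖y - (a : ℕ)‖ ≤ (p : ℝ)⁻¹) (hb : ‖y - (b : ℕ)‖ ≤ (p : ℝ)⁻¹) : a = b := by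
  have hp : (p : ℝ)⁻¹ < 1 := inv_lt_one_of_one_lt₀ (by exact_mod_cast (Fact.out : p.Prime).one_lt)
  have h : ‖((((a : ℕ) : ℤ) - ((b : ℕ) : ℤ) : ℤ) : ℚ_[p])‖ < 1 := by
    have : ((((a : ℕ) : ℤ) - ((b : ℕ) : ℤ) : ℤ) : ℚ_[p]) = (y - (b : ℕ)) - (y - (a : ℕ)) := by
      push_cast; ring
    rw [this]
    rw [sub_eq_add_neg]
    exact ((Padic.nonarchimedean _ _).trans (max_le hb (by rwa [norm_neg]))).trans_lt hp
  rw [Padic.norm_intCast_lt_one_iff] at h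
  have := Int.eq_zero_of_abs_lt_dvd h (by rw [abs_lt]; constructor <;> omega)
  ext; omega

lemma ball_step {p : ℕ} [Fact p.Prime] {n : ℕ}
    [MeasurableSpace (Fin n → ℚ_[p])] [BorelSpace (Fin n → ℚ_[p])]
    (μ : Measure (Fin n → ℚ_[p])) [μ.IsAddHaarMeasure] (k : ℤ) :
    μ (Metric.closedBall 0 ((p : ℝ) ^ (k + 1))) =
      (p : ENNReal) ^ n * μ (Metric.closedBall 0 ((p : ℝ) ^ k)) := by
  have hp0 : (0 : ℝ) < p := by exact_mod_cast (Fact.out : p.Prime).pos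
  have hpq : (p : ℚ_[p]) ≠ 0 := by exact_mod_cast (Fact.out : p.Prime).ne_zero
  let v : (Fin n → Fin p) → (Fin n → ℚ_[p]) := fun a i => (p : ℚ_[p]) ^ (-(k + 1)) * ((a i : ℕ) : ℚ_[p])
  have key : ∀ (x : ℚ_[p]) (a : Fin p), ‖x - (p : ℚ_[p]) ^ (-(k + 1)) * ((a : ℕ) : ℚ_[p])‖ ≤ (p : ℝ) ^ k ↔
      ‖(p : ℚ_[p]) ^ (k + 1) * x - ((a : ℕ) : ℚ_[p])‖ ≤ (p : ℝ)⁻¹ := by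
    intro x a
    have : (p : ℚ_[p]) ^ (k + 1) * x - ((a : ℕ) : ℚ_[p]) =
      (p : ℚ_[p]) ^ (k + 1) * (x - (p : ℚ_[p]) ^ (-(k + 1)) * ((a : ℕ) : ℚ_[p])) := by
      rw [mul_sub, ← mul_assoc, ← zpow_add₀ hpq]; simp
    rw [this, norm_mul, Padic.norm_p_zpow, zpow_neg (p : ℝ), zpow_add₀ hp0.ne', zpow_one, inv_mul_le_iff₀ (by positivity)]
    rw [mul_assoc, mul_inv_cancel₀ hp0.ne', mul_one]
  have mem : ∀ x (a : Fin n → Fin p), x ∈ Metric.closedBall (v a) ((p : ℝ) ^ k) ↔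
      ∀ i, ‖(p : ℚ_[p]) ^ (k + 1) * x i - ((a i : ℕ) : ℚ_[p])‖ ≤ (p : ℝ)⁻¹ := by
    intro x a
    rw [mem_closedBall_iff_norm, pi_norm_le_iff_of_nonneg (by positivity)]
    exact forall_congr' fun i => key _ _
  have hU : Metric.closedBall (0 : Fin n → ℚ_[p]) ((p : ℝ) ^ (k + 1)) =
      ⋃ a, Metric.closedBall (v a) ((p : ℝ) ^ k) := by
    ext x
    rw [Set.mem_iUnion, mem_closedBall_zero_iff, pi_norm_le_iff_of_nonneg (by positivity)]
    have e : ∀ i, ‖x i‖ ≤ (p : ℝ) ^ (k + 1) ↔ ‖(p : ℚ_[p]) ^ (k + 1) * x i‖ ≤ 1 := by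
      intro i
      rw [norm_mul, Padic.norm_p_zpow, zpow_neg, inv_mul_le_iff₀ (by positivity), mul_one]
    constructor
    · intro h
      choose a ha using fun i => aux_cover _ ((e i).1 (h i))
      exact ⟨a, (mem x a).2 ha⟩
    · rintro ⟨a, ha⟩ i
      rw [e]
      have h1 := (mem x a).1 ha i
      have : (p : ℚ_[p]) ^ (k + 1) * x i = ((p : ℚ_[p]) ^ (k + 1) * x i - ((a i : ℕ) : ℚ_[p])) + ((a i : ℕ) : ℚ_[p]) := by ring
      rw [this]
      refine (Padic.nonarchimedean _ _).trans (max_le (h1.trans ?_) ?_)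
      · exact inv_le_one_of_one_le₀ (by exact_mod_cast (Fact.out : p.Prime).one_lt.le)
      · simpa using Padic.norm_int_le_one (p := p) (a i : ℕ)
  have hd : Pairwise (Function.onFun Disjoint fun a => Metric.closedBall (v a) ((p : ℝ) ^ k)) := by
    intro a b hab
    rw [Function.onFun, Set.disjoint_left]
    intro x hx hx'
    exact hab (funext fun i => aux_inj _ _ _ ((mem x a).1 hx i) ((mem x b).1 hx' i))
  rw [hU, measure_iUnion hd (fun _ => Metric.isClosed_closedBall.measurableSet), tsum_fintype]
  have : ∀ a, μ (Metric.closedBall (v a) ((p : ℝ) ^ k)) = μ (Metric.closedBall 0 ((p : ℝ) ^ k)) := by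
    intro a
    have h := measure_preimage_add μ (-(v a)) (Metric.closedBall 0 ((p : ℝ) ^ k))
    rw [← h]
    congr 1
    ext x
    simp [dist_eq_norm, sub_eq_add_neg, add_comm]
  simp [this]

lemma ball_zpow {p : ℕ} [Fact p.Prime] {n : ℕ}
    [MeasurableSpace (Fin n → ℚ_[p])] [BorelSpace (Fin n → ℚ_[p])]
    (μ : Measure (Fin n → ℚ_[p])) [μ.IsAddHaarMeasure]
    (hμ : μ (Metric.closedBall 0 1) = 1) (k : ℤ) :
    μ (Metric.closedBall 0 ((p : ℝ) ^ k)) = ENNReal.ofReal (((p : ℝ) ^ k) ^ n) := by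
  have hp0 : (0 : ℝ) < p := by exact_mod_cast (Fact.out : p.Prime).pos
  have hpe : (p : ENNReal) ^ n = ENNReal.ofReal ((p : ℝ) ^ n) := by
    rw [ENNReal.ofReal_pow hp0.le, ENNReal.ofReal_natCast]
  have hs : ∀ k : ℤ, ENNReal.ofReal (((p : ℝ) ^ (k + 1)) ^ n) =
      (p : ENNReal) ^ n * ENNReal.ofReal (((p : ℝ) ^ k) ^ n) := by
    intro k
    rw [hpe, ← ENNReal.ofReal_mul (by positivity), zpow_add_one₀ hp0.ne', mul_pow, mul_comm]
  have hn0 : (p : ENNReal) ^ n ≠ 0 := by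
    rw [hpe]; exact (ENNReal.ofReal_pos.2 (by positivity)).ne'
  have hnt : (p : ENNReal) ^ n ≠ ⊤ := by rw [hpe]; exact ENNReal.ofReal_ne_top
  induction k using Int.induction_on with
  | zero => simpa using hμ
  | succ k ih => rw [ball_step, ih, hs]
  | pred k ih =>
    have e : (-(k : ℤ)) = (-(k : ℤ) - 1) + 1 := by ring
    rw [e, ball_step, hs] at ih
    exact (ENNReal.mul_right_inj hn0 hnt).1 ih

lemma ball_le {p : ℕ} [Fact p.Prime] {n : ℕ}
    [MeasurableSpace (Fin n → ℚ_[p])] [BorelSpace (Fin n → ℚ_[p])]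
    (μ : Measure (Fin n → ℚ_[p])) [μ.IsAddHaarMeasure]
    (hμ : μ (Metric.closedBall 0 1) = 1) (R : ℝ) (hR : 0 < R) :
    μ (Metric.closedBall 0 R) ≤ ENNReal.ofReal ((p * R) ^ n) := by
  have hp1 : (1 : ℝ) < p := by exact_mod_cast (Fact.out : p.Prime).one_lt
  obtain ⟨k, hk1, hk2⟩ := exists_mem_Ioc_zpow hR hp1
  refine (measure_mono (Metric.closedBall_subset_closedBall hk2)).trans ?_
  rw [ball_zpow μ hμ]
  apply ENNReal.ofReal_le_ofReal
  have : (0:ℝ) < p := by linarith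
  gcongr
  rw [zpow_add_one₀ (by positivity), mul_comm]
  gcongr

lemma lint_le {p : ℕ} [Fact p.Prime] {n : ℕ}
    [MeasurableSpace (Fin n → ℚ_[p])] [BorelSpace (Fin n → ℚ_[p])]
    (μ : Measure (Fin n → ℚ_[p])) [μ.IsAddHaarMeasure]
    (hμ : μ (Metric.closedBall 0 1) = 1) (b : ℝ) (hb : 0 < b) :
    ∃ D > (0 : ℝ), ∀ c : ℝ, 0 < c →
      ∫⁻ η, ENNReal.ofReal ((c + ‖η‖) ^ (-(n : ℝ) - b)) ∂μ ≤ ENNReal.ofReal (D * c ^ (-b)) := by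
  have hp0 : (0 : ℝ) < p := by exact_mod_cast (Fact.out : p.Prime).pos
  set q : ℝ := 2 ^ (-b) with hq
  have hq0 : 0 < q := by positivity
  have hq1 : q < 1 := Real.rpow_lt_one_of_one_lt_of_neg (by norm_num) (by linarith)
  refine ⟨(2 * p) ^ n * (1 - q)⁻¹, mul_pos (by positivity) (inv_pos.2 (by linarith)), fun c hc => ?_⟩
  have pt : ∀ η : Fin n → ℚ_[p], ENNReal.ofReal ((c + ‖η‖) ^ (-(n : ℝ) - b)) ≤
      ∑' j : ℕ, (Metric.closedBall (0 : Fin n → ℚ_[p]) (2 ^ (j + 1) * c)).indicator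
        (fun _ => ENNReal.ofReal ((2 ^ j * c) ^ (-(n : ℝ) - b))) η := by
    intro η
    obtain ⟨j, hj1, hj2⟩ := exists_nat_pow_near (x := (c + ‖η‖) / c) (y := (2:ℝ))
      (by rw [le_div_iff₀ hc]; linarith [norm_nonneg η]) (by norm_num)
    rw [le_div_iff₀ hc] at hj1
    rw [div_lt_iff₀ hc] at hj2
    refine le_trans ?_ (ENNReal.le_tsum j)
    rw [Set.indicator_of_mem (by rw [mem_closedBall_zero_iff]; linarith)]
    apply ENNReal.ofReal_le_ofReal
    exact Real.rpow_le_rpow_of_nonpos (by positivity) hj1 (by linarith [(Nat.cast_nonneg n : (0:ℝ) ≤ n)])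
  calc _ ≤ ∫⁻ η, ∑' j : ℕ, (Metric.closedBall (0 : Fin n → ℚ_[p]) (2 ^ (j + 1) * c)).indicator
        (fun _ => ENNReal.ofReal ((2 ^ j * c) ^ (-(n : ℝ) - b))) η ∂μ := lintegral_mono pt
    _ = ∑' j : ℕ, ENNReal.ofReal ((2 ^ j * c) ^ (-(n : ℝ) - b)) *
          μ (Metric.closedBall (0 : Fin n → ℚ_[p]) (2 ^ (j + 1) * c)) := by
        rw [lintegral_tsum]
        · congr 1; ext j
          rw [lintegral_indicator_const Metric.isClosed_closedBall.measurableSet]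
        · intro j
          exact (measurable_const.indicator Metric.isClosed_closedBall.measurableSet).aemeasurable
    _ ≤ ∑' j : ℕ, ENNReal.ofReal ((2 * p) ^ n * c ^ (-b) * q ^ j) := by
        refine ENNReal.tsum_le_tsum fun j => ?_
        refine (mul_le_mul_right (ball_le μ hμ _ (by positivity)) _).trans ?_
        rw [← ENNReal.ofReal_mul (by positivity)]
        apply ENNReal.ofReal_le_ofReal
        apply le_of_eq
        have e1 : q ^ j = ((2:ℝ) ^ j) ^ (-b) := by
          rw [hq, ← Real.rpow_natCast, ← Real.rpow_natCast, ← Real.rpow_mul (by norm_num),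
            ← Real.rpow_mul (by norm_num), mul_comm]
        have e2 : (2 ^ j * c) ^ (-(n : ℝ) - b) = ((2 ^ j * c) ^ n)⁻¹ * (2 ^ j) ^ (-b) * c ^ (-b) := by
          rw [sub_eq_add_neg, Real.rpow_add (by positivity), Real.rpow_neg (by positivity), Real.rpow_natCast,
            Real.mul_rpow (by positivity) hc.le, mul_assoc]
        have e3 : ((p:ℝ) * (2 ^ (j + 1) * c)) ^ n = (2 * p) ^ n * (2 ^ j * c) ^ n := by
          rw [← mul_pow]; congr 1; ring
        rw [e1, e2, e3]
        have : (2 ^ j * c) ^ n ≠ 0 := by positivity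
        field_simp
    _ = ENNReal.ofReal (∑' j : ℕ, (2 * p) ^ n * c ^ (-b) * q ^ j) := by
        rw [ENNReal.ofReal_tsum_of_nonneg (fun j => by positivity)]
        exact (summable_geometric_of_lt_one hq0.le hq1).mul_left _
    _ = _ := by
        rw [tsum_mul_left, tsum_geometric_of_lt_one hq0.le hq1]
        congr 1; ring

lemma int_le {p : ℕ} [Fact p.Prime] {n : ℕ}
    [MeasurableSpace (Fin n → ℚ_[p])] [BorelSpace (Fin n → ℚ_[p])]
    (μ : Measure (Fin n → ℚ_[p])) [μ.IsAddHaarMeasure]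
    (hμ : μ (Metric.closedBall 0 1) = 1) (b : ℝ) (hb : 0 < b) :
    ∃ D > (0 : ℝ), ∀ c : ℝ, 0 < c → ∀ x,
      Integrable (fun η => (c + ‖η - x‖) ^ (-(n : ℝ) - b)) μ ∧
      ∫ η, (c + ‖η - x‖) ^ (-(n : ℝ) - b) ∂μ ≤ D * c ^ (-b) := by
  obtain ⟨D, hD, h⟩ := lint_le μ hμ b hb
  refine ⟨D, hD, fun c hc x => ?_⟩
  have hcont : Continuous (fun η : Fin n → ℚ_[p] => (c + ‖η‖) ^ (-(n : ℝ) - b)) := by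
    refine Continuous.rpow_const (by fun_prop) fun η => Or.inl ?_
    positivity
  have hnn : ∀ η : Fin n → ℚ_[p], 0 ≤ (c + ‖η‖) ^ (-(n : ℝ) - b) := fun η => by positivity
  have hi : Integrable (fun η : Fin n → ℚ_[p] => (c + ‖η‖) ^ (-(n : ℝ) - b)) μ := by
    refine ⟨hcont.aestronglyMeasurable, ?_⟩
    rw [hasFiniteIntegral_iff_ofReal (Filter.Eventually.of_forall hnn)]
    exact (h c hc).trans_lt ENNReal.ofReal_lt_top
  refine ⟨hi.comp_sub_right x, ?_⟩
  rw [integral_sub_right_eq_self (fun η : Fin n → ℚ_[p] => (c + ‖η‖) ^ (-(n : ℝ) - b)) x,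
    integral_eq_lintegral_of_nonneg_ae (Filter.Eventually.of_forall hnn) hcont.aestronglyMeasurable]
  exact ENNReal.toReal_le_of_le_ofReal (by positivity) (h c hc)

lemma beta_integrable (u v : ℝ) (hu : 0 < u) (hv : 0 < v) :
    IntervalIntegrable (fun s : ℝ => s ^ (u - 1) * (1 - s) ^ (v - 1)) volume 0 1 := by
  have h := Complex.betaIntegral_convergent (u := u) (v := v) (by simpa) (by simpa)
  rw [intervalIntegrable_iff_integrableOn_Ioc_of_le (by simp)] at h ⊢
  refine IntegrableOn.congr_fun h.re (fun x hx => ?_) measurableSet_Ioc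
  have h1 : ((x : ℂ) ^ ((u : ℂ) - 1) * (1 - (x : ℂ)) ^ ((v : ℂ) - 1)) =
      ((x ^ (u - 1) * (1 - x) ^ (v - 1) : ℝ) : ℂ) := by
    rw [Complex.ofReal_mul, Complex.ofReal_cpow hx.1.le, Complex.ofReal_cpow (by linarith [hx.2])]
    push_cast; rfl
  simp only [h1]
  simp

lemma beta_scaled (u v : ℝ) (hu : 0 < u) (hv : 0 < v) (t τ : ℝ) (h : τ < t) :
    IntegrableOn (fun θ : ℝ => (t - θ) ^ (u - 1) * (θ - τ) ^ (v - 1)) (Set.Ioo τ t) ∧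
    ∫ θ in Set.Ioo τ t, (t - θ) ^ (u - 1) * (θ - τ) ^ (v - 1) =
      realBeta u v * (t - τ) ^ (u + v - 1) := by
  have hL : 0 < t - τ := by linarith
  have e : ∀ θ ∈ Set.Ioo τ t, (t - τ) ^ (u + v - 2) *
      (((t - τ)⁻¹ * (t - θ)) ^ (u - 1) * (1 - (t - τ)⁻¹ * (t - θ)) ^ (v - 1)) =
      (t - θ) ^ (u - 1) * (θ - τ) ^ (v - 1) := by
    intro θ hθ
    have h1 : 1 - (t - τ)⁻¹ * (t - θ) = (t - τ)⁻¹ * (θ - τ) := by field_simp; ring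
    have h2 : (t - τ) ^ (u + v - 2) = (t - τ) ^ (u - 1) * (t - τ) ^ (v - 1) := by
      rw [← Real.rpow_add hL]; congr 1; ring
    rw [h1, h2, Real.mul_rpow (by positivity) (by linarith [hθ.2]),
      Real.mul_rpow (by positivity) (by linarith [hθ.1]), Real.inv_rpow hL.le, Real.inv_rpow hL.le]
    have := (Real.rpow_pos_of_pos hL (u - 1)).ne'
    have := (Real.rpow_pos_of_pos hL (v - 1)).ne'
    field_simp
  have hi := beta_integrable u v hu hv
  constructor
  · have h1 := ((hi.comp_mul_left (c := (t - τ)⁻¹)).comp_sub_left t).const_mul ((t - τ) ^ (u + v - 2))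
    have e1 : t - 0 / (t - τ)⁻¹ = t := by simp
    have e2 : t - 1 / (t - τ)⁻¹ = τ := by simp
    rw [e1, e2] at h1
    have h2 := (intervalIntegrable_iff_integrableOn_Ioo_of_le h.le).1 h1.symm
    exact h2.congr_fun e measurableSet_Ioo
  · rw [← setIntegral_congr_fun measurableSet_Ioo e, integral_const_mul, ← integral_Ioc_eq_integral_Ioo,
      ← intervalIntegral.integral_of_le h.le]
    rw [intervalIntegral.integral_comp_sub_left (fun y => ((t - τ)⁻¹ * y) ^ (u - 1) * (1 - (t - τ)⁻¹ * y) ^ (v - 1)) t,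
      intervalIntegral.integral_comp_mul_left (fun y => y ^ (u - 1) * (1 - y) ^ (v - 1)) (inv_ne_zero hL.ne')]
    rw [sub_self, mul_zero, inv_mul_cancel₀ hL.ne', intervalIntegral.integral_of_le zero_le_one,
      integral_Ioc_eq_integral_Ioo, inv_inv, smul_eq_mul]
    change _ * (_ * realBeta u v) = _
    have : (t - τ) ^ (u + v - 1) = (t - τ) ^ (u + v - 2) * (t - τ) := by
      rw [← Real.rpow_add_one hL.ne']; congr 1; ring
    rw [this]; ring

lemma realBeta_nonneg (u v : ℝ) : 0 ≤ realBeta u v := by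
  refine setIntegral_nonneg measurableSet_Ioo fun s hs => ?_
  exact mul_nonneg (Real.rpow_nonneg hs.1.le _) (Real.rpow_nonneg (by linarith [hs.2]) _)

lemma pt_bound (m₁ m₂ k X Z Y : ℝ) (hm₁ : m₁ ≤ 0) (hm₂ : m₂ ≤ 0) (hk : 0 < k) (hX : 0 < X) (hZ : 0 < Z)
    (hY : 0 < Y) (h : 2 * (k * Y) ≤ X + Z) :
    X ^ m₁ * Z ^ m₂ ≤ k ^ m₁ * Y ^ m₁ * Z ^ m₂ + k ^ m₂ * Y ^ m₂ * X ^ m₁ := by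
  rcases le_total (k * Y) X with h1 | h1
  · have := Real.rpow_le_rpow_of_nonpos (by positivity) h1 hm₁
    rw [Real.mul_rpow hk.le hY.le] at this
    have h2 : X ^ m₁ * Z ^ m₂ ≤ k ^ m₁ * Y ^ m₁ * Z ^ m₂ := by gcongr
    have : 0 ≤ k ^ m₂ * Y ^ m₂ * X ^ m₁ := by positivity
    linarith
  · have := Real.rpow_le_rpow_of_nonpos (by positivity) (show k * Y ≤ Z by linarith) hm₂
    rw [Real.mul_rpow hk.le hY.le] at this
    have h2 : X ^ m₁ * Z ^ m₂ ≤ k ^ m₂ * Y ^ m₂ * X ^ m₁ := by rw [mul_comm]; gcongr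
    have : 0 ≤ k ^ m₁ * Y ^ m₁ * Z ^ m₂ := by positivity
    linarith

lemma time_bound (β b A B : ℝ) (hb : 0 < b) (hβ : b ≤ β) (hA : 0 < A) (hB : 0 < B) :
    2 ^ (-1 / b) * (A + B) ^ (1 / β) ≤ A ^ (1 / β) + B ^ (1 / β) := by
  have hβ0 : 0 < β := hb.trans_le hβ
  have h1 : (2 : ℝ) ^ (-1 / b) ≤ (1 / 2) ^ (1 / β) := by
    rw [one_div 2, Real.inv_rpow (by norm_num), ← Real.rpow_neg (by norm_num)]
    apply Real.rpow_le_rpow_of_exponent_le (by norm_num)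
    rw [neg_div, neg_le_neg_iff]
    exact one_div_le_one_div_of_le hb hβ
  have h2 : 2 ^ (-1 / b) * (A + B) ^ (1 / β) ≤ ((1 / 2) * (A + B)) ^ (1 / β) := by
    rw [Real.mul_rpow (by norm_num) (by positivity)]
    gcongr
  refine h2.trans ?_
  rcases le_total A B with h | h
  · have := Real.rpow_le_rpow (by positivity) (show (1 / 2) * (A + B) ≤ B by linarith) (show 0 ≤ 1 / β by positivity)
    have : 0 ≤ A ^ (1 / β) := by positivity
    linarith
  · have := Real.rpow_le_rpow (by positivity) (show (1 / 2) * (A + B) ≤ A by linarith) (show 0 ≤ 1 / β by positivity)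
    have : 0 ≤ B ^ (1 / β) := by positivity
    linarith

/-- p-adic composition estimate for heat-kernel-type bounds
(Kochubei, Lemma 4.6). -/
theorem stmt8 {p : ℕ} [Fact p.Prime] {n : ℕ}
    [MeasurableSpace (Fin n → ℚ_[p])] [BorelSpace (Fin n → ℚ_[p])]
    (μ : Measure (Fin n → ℚ_[p])) [μ.IsAddHaarMeasure]
    (hμ : μ (Metric.closedBall 0 1) = 1)
    (b₁ b₂ : ℝ) (hb₁ : 0 < b₁) (hb₂ : 0 < b₂) :
    ∃ C > (0 : ℝ), ∀ (β ρ σ : ℝ), 0 < β → 0 ≤ ρ → 0 ≤ σ →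
      ρ + b₁ < β → σ + b₂ < β →
      ∀ (t τ : ℝ), 0 ≤ τ → τ < t → ∀ x ξ : Fin n → ℚ_[p],
      (∫ θ in Set.Ioo τ t, (t - θ) ^ (-ρ / β) * (θ - τ) ^ (-σ / β) *
          ∫ η : Fin n → ℚ_[p],
            ((t - θ) ^ (1 / β) + ‖x - η‖) ^ (-(n : ℝ) - b₁) *
            ((θ - τ) ^ (1 / β) + ‖η - ξ‖) ^ (-(n : ℝ) - b₂) ∂μ) ≤
        C * (realBeta (1 - ρ / β) (1 - (σ + b₂) / β) *
              ((t - τ) ^ (1 / β) + ‖x - ξ‖) ^ (-(n : ℝ) - b₁) *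
              (t - τ) ^ (-(ρ + σ + b₂ - β) / β) +
             realBeta (1 - (ρ + b₁) / β) (1 - σ / β) *
              ((t - τ) ^ (1 / β) + ‖x - ξ‖) ^ (-(n : ℝ) - b₂) *
              (t - τ) ^ (-(ρ + σ + b₁ - β) / β)) := by
  obtain ⟨D₁, hD₁, H₁⟩ := int_le μ hμ b₁ hb₁
  obtain ⟨D₂, hD₂, H₂⟩ := int_le μ hμ b₂ hb₂
  set m₁ : ℝ := -(n : ℝ) - b₁ with hm₁
  set m₂ : ℝ := -(n : ℝ) - b₂ with hm₂
  have hn : (0 : ℝ) ≤ n := Nat.cast_nonneg n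
  have hm₁0 : m₁ ≤ 0 := by linarith
  have hm₂0 : m₂ ≤ 0 := by linarith
  set k : ℝ := 2 ^ (-1 / b₁) / 2 with hk
  have hk0 : 0 < k := by positivity
  have hk1 : 2 * k ≤ 1 := by
    have : (2 : ℝ) ^ (-1 / b₁) ≤ 1 := by
      apply Real.rpow_le_one_of_one_le_of_nonpos (by norm_num)
      exact div_nonpos_of_nonpos_of_nonneg (by norm_num) hb₁.le
    rw [hk]; linarith
  refine ⟨k ^ m₁ * D₂ + k ^ m₂ * D₁, by positivity, ?_⟩
  intro β ρ σ hβ hρ hσ hρb hσb t τ _ hτt x ξ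
  have hL : 0 < t - τ := by linarith
  set Y : ℝ := (t - τ) ^ (1 / β) + ‖x - ξ‖ with hY
  have hY0 : 0 < Y := by positivity
  -- inner bound
  have inner : ∀ θ ∈ Set.Ioo τ t, (∫ η : Fin n → ℚ_[p],
            ((t - θ) ^ (1 / β) + ‖x - η‖) ^ m₁ * ((θ - τ) ^ (1 / β) + ‖η - ξ‖) ^ m₂ ∂μ) ≤
      k ^ m₁ * Y ^ m₁ * (D₂ * (θ - τ) ^ (-b₂ / β)) + k ^ m₂ * Y ^ m₂ * (D₁ * (t - θ) ^ (-b₁ / β)) := by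
    intro θ hθ
    have hA : 0 < t - θ := by linarith [hθ.2]
    have hB : 0 < θ - τ := by linarith [hθ.1]
    have hA' : 0 < (t - θ) ^ (1 / β) := by positivity
    have hB' : 0 < (θ - τ) ^ (1 / β) := by positivity
    obtain ⟨i1, j1⟩ := H₁ _ hA' x
    obtain ⟨i2, j2⟩ := H₂ _ hB' ξ
    have eA : ((t - θ) ^ (1 / β)) ^ (-b₁) = (t - θ) ^ (-b₁ / β) := by
      rw [← Real.rpow_mul hA.le]; congr 1; ring
    have eB : ((θ - τ) ^ (1 / β)) ^ (-b₂) = (θ - τ) ^ (-b₂ / β) := by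
      rw [← Real.rpow_mul hB.le]; congr 1; ring
    rw [eA] at j1
    rw [eB] at j2
    have hT := time_bound β b₁ (t - θ) (θ - τ) hb₁ (by linarith) hA hB
    rw [show t - θ + (θ - τ) = t - τ by ring] at hT
    calc _ ≤ ∫ η : Fin n → ℚ_[p], (k ^ m₁ * Y ^ m₁ * ((θ - τ) ^ (1 / β) + ‖η - ξ‖) ^ m₂ +
          k ^ m₂ * Y ^ m₂ * ((t - θ) ^ (1 / β) + ‖η - x‖) ^ m₁) ∂μ := by
          refine integral_mono_of_nonneg (Filter.Eventually.of_forall fun η => ?_)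
            ((i2.const_mul _).add (i1.const_mul _)) (Filter.Eventually.of_forall fun η => ?_)
          · simp only [Pi.zero_apply]; positivity
          · simp only
            rw [norm_sub_rev x η]
            apply pt_bound _ _ _ _ _ _ hm₁0 hm₂0 hk0 (by positivity) (by positivity) hY0
            have h1 : ‖x - ξ‖ ≤ ‖η - x‖ + ‖η - ξ‖ := by
              rw [norm_sub_rev η x]
              exact norm_sub_le_norm_sub_add_norm_sub x η ξ
            have h2 : 2 * k * ‖x - ξ‖ ≤ ‖x - ξ‖ := mul_le_of_le_one_left (norm_nonneg _) hk1
            have h3 : 2 * (k * Y) = 2 ^ (-1 / b₁) * (t - τ) ^ (1 / β) + 2 * k * ‖x - ξ‖ := by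
              rw [hY, hk]; ring
            rw [h3]; linarith
      _ = k ^ m₁ * Y ^ m₁ * (∫ η : Fin n → ℚ_[p], ((θ - τ) ^ (1 / β) + ‖η - ξ‖) ^ m₂ ∂μ) +
          k ^ m₂ * Y ^ m₂ * (∫ η : Fin n → ℚ_[p], ((t - θ) ^ (1 / β) + ‖η - x‖) ^ m₁ ∂μ) := by
          rw [integral_add (i2.const_mul _) (i1.const_mul _), integral_const_mul, integral_const_mul]
      _ ≤ _ := by gcongr
  have hρ1 : ρ / β < 1 := by rw [div_lt_one hβ]; linarith
  have hσ1 : σ / β < 1 := by rw [div_lt_one hβ]; linarith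
  have hρ2 : (ρ + b₁) / β < 1 := by rw [div_lt_one hβ]; linarith
  have hσ2 : (σ + b₂) / β < 1 := by rw [div_lt_one hβ]; linarith
  obtain ⟨I1, J1⟩ := beta_scaled (1 - ρ / β) (1 - (σ + b₂) / β) (by linarith) (by linarith) t τ hτt
  obtain ⟨I2, J2⟩ := beta_scaled (1 - (ρ + b₁) / β) (1 - σ / β) (by linarith) (by linarith) t τ hτt
  have x1 : 1 - ρ / β + (1 - (σ + b₂) / β) - 1 = -(ρ + σ + b₂ - β) / β := by field_simp; ring
  have x2 : 1 - (ρ + b₁) / β + (1 - σ / β) - 1 = -(ρ + σ + b₁ - β) / β := by field_simp; ring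
  rw [x1] at J1
  rw [x2] at J2
  set f1 : ℝ → ℝ := fun θ => (t - θ) ^ (1 - ρ / β - 1) * (θ - τ) ^ (1 - (σ + b₂) / β - 1) with hf1
  set f2 : ℝ → ℝ := fun θ => (t - θ) ^ (1 - (ρ + b₁) / β - 1) * (θ - τ) ^ (1 - σ / β - 1) with hf2
  have outer : (∫ θ in Set.Ioo τ t, (t - θ) ^ (-ρ / β) * (θ - τ) ^ (-σ / β) *
          ∫ η : Fin n → ℚ_[p],
            ((t - θ) ^ (1 / β) + ‖x - η‖) ^ m₁ * ((θ - τ) ^ (1 / β) + ‖η - ξ‖) ^ m₂ ∂μ) ≤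
      ∫ θ in Set.Ioo τ t, (k ^ m₁ * D₂ * Y ^ m₁ * f1 θ + k ^ m₂ * D₁ * Y ^ m₂ * f2 θ) := by
    refine integral_mono_of_nonneg ?_ ((I1.const_mul _).add (I2.const_mul _)) ?_
    · refine ae_restrict_of_forall_mem measurableSet_Ioo fun θ hθ => ?_
      have hA : 0 < t - θ := by linarith [hθ.2]
      have hB : 0 < θ - τ := by linarith [hθ.1]
      have : 0 ≤ ∫ η : Fin n → ℚ_[p],
            ((t - θ) ^ (1 / β) + ‖x - η‖) ^ m₁ * ((θ - τ) ^ (1 / β) + ‖η - ξ‖) ^ m₂ ∂μ :=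
        integral_nonneg fun η => by simp only [Pi.zero_apply]; positivity
      simp only [Pi.zero_apply]
      positivity
    · refine ae_restrict_of_forall_mem measurableSet_Ioo fun θ hθ => ?_
      have hA : 0 < t - θ := by linarith [hθ.2]
      have hB : 0 < θ - τ := by linarith [hθ.1]
      have g1 : f1 θ = (t - θ) ^ (-ρ / β) * ((θ - τ) ^ (-σ / β) * (θ - τ) ^ (-b₂ / β)) := by
        rw [← Real.rpow_add hB, hf1]; simp only
        congr 2 <;> ring
      have g2 : f2 θ = ((t - θ) ^ (-ρ / β) * (t - θ) ^ (-b₁ / β)) * (θ - τ) ^ (-σ / β) := by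
        rw [← Real.rpow_add hA, hf2]; simp only
        congr 2 <;> ring
      simp only
      rw [g1, g2]
      refine (mul_le_mul_of_nonneg_left (inner θ hθ) (by positivity)).trans (le_of_eq ?_)
      ring
  refine outer.trans ?_
  rw [integral_add (I1.const_mul _) (I2.const_mul _), integral_const_mul, integral_const_mul, J1, J2]
  have B1 := realBeta_nonneg (1 - ρ / β) (1 - (σ + b₂) / β)
  have B2 := realBeta_nonneg (1 - (ρ + b₁) / β) (1 - σ / β)
  set R1 := realBeta (1 - ρ / β) (1 - (σ + b₂) / β)
  set R2 := realBeta (1 - (ρ + b₁) / β) (1 - σ / β)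
  have n1 : 0 ≤ (k ^ m₂ * D₁) * (R1 * Y ^ m₁ * (t - τ) ^ (-(ρ + σ + b₂ - β) / β)) := by positivity
  have n2 : 0 ≤ (k ^ m₁ * D₂) * (R2 * Y ^ m₂ * (t - τ) ^ (-(ρ + σ + b₁ - β) / β)) := by positivity
  linarith
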